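/- arXiv:1805.10562 — 3 statements merged into one kernel-verified Lean document; each statement's English description precedes it below -/
import Mathlib

section
/- Let q ≥ 2 be an integer, m ≥ 2, and 1 ≤ h ≤ m−1. For every integer a ≥ 1 whose base-q weight is at most h, there exists an integer ã with 1 ≤ ã ≤ q^m − 2 such that ã ≡ a (mod q^m − 1) and the base-q weight of ã is at most h. -/
/-- Base-`q` weight of a natural number: the number of nonzero digits in its
base-`q` expansion. -/
def wtq (q a : ℕ) : ℕ := ((Nat.digits q a).filter (fun d => d ≠ 0)).length

theorem wtq_mul_add (q n r : ℕ) (hq : 2 ≤ q) (hr : r < q) :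
    wtq q (q * n + r) = (if r = 0 then 0 else 1) + wtq q n := by
  rcases Nat.eq_zero_or_pos (q * n + r) with h0 | hpos
  · obtain ⟨h1, rfl⟩ := Nat.add_eq_zero_iff.mp h0
    obtain rfl : n = 0 := (Nat.mul_eq_zero.mp h1).resolve_left (by omega)
    simp
  · have hd : (q * n + r) / q = n := by
      rw [Nat.mul_add_div (by omega), Nat.div_eq_of_lt hr, add_zero]
    have hm : (q * n + r) % q = r := by
      rw [Nat.mul_add_mod, Nat.mod_eq_of_lt hr]
    unfold wtq
    rw [Nat.digits_def' (by omega) hpos, hd, hm]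
    by_cases h : r = 0
    · simp [h]
    · simp [h, add_comm]

theorem wtq_succ_le (q : ℕ) (hq : 2 ≤ q) (a : ℕ) : wtq q (a + 1) ≤ wtq q a + 1 := by
  induction a using Nat.strong_induction_on with
  | _ a ih =>
    have ha := Nat.div_add_mod a q
    have hr : a % q < q := Nat.mod_lt _ (by omega)
    have hwa := wtq_mul_add q (a / q) (a % q) hq hr
    rw [ha] at hwa
    by_cases hc : a % q + 1 < q
    · have h := wtq_mul_add q (a / q) (a % q + 1) hq hc
      rw [← add_assoc, ha] at h
      rw [h, hwa]
      split_ifs <;> omega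
    · have h := wtq_mul_add q (a / q + 1) 0 hq (by omega)
      have he : q * (a / q + 1) + 0 = a + 1 := by
        rw [mul_add]
        omega
      have hlt : a / q < a := by
        refine Nat.div_lt_self (Nat.pos_of_ne_zero ?_) (by omega)
        rintro rfl
        simp at hc
        omega
      have := ih _ hlt
      rw [he] at h
      rw [h, hwa]
      split_ifs <;> omega

theorem wtq_add_le (q : ℕ) (hq : 2 ≤ q) (a b : ℕ) :
    wtq q (a + b) ≤ wtq q a + wtq q b := by
  induction a using Nat.strong_induction_on generalizing b with
  | _ a ih =>
    rcases Nat.eq_zero_or_pos a with rfl | hpos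
    · simp
    have ha := Nat.div_add_mod a q
    have hb := Nat.div_add_mod b q
    have hr : a % q < q := Nat.mod_lt _ (by omega)
    have hs : b % q < q := Nat.mod_lt _ (by omega)
    have hwa := wtq_mul_add q (a / q) (a % q) hq hr
    have hwb := wtq_mul_add q (b / q) (b % q) hq hs
    rw [ha] at hwa
    rw [hb] at hwb
    have hi := ih (a / q) (Nat.div_lt_self hpos (by omega)) (b / q)
    by_cases hc : a % q + b % q < q
    · have h := wtq_mul_add q (a / q + b / q) (a % q + b % q) hq hc
      have he : q * (a / q + b / q) + (a % q + b % q) = a + b := by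
        rw [mul_add]
        omega
      rw [he] at h
      rw [h, hwa, hwb]
      split_ifs <;> omega
    · have h := wtq_mul_add q (a / q + b / q + 1) (a % q + b % q - q) hq (by omega)
      have he : q * (a / q + b / q + 1) + (a % q + b % q - q) = a + b := by
        rw [mul_add, mul_add]
        omega
      have hsucc := wtq_succ_le q hq (a / q + b / q)
      rw [he] at h
      rw [h, hwa, hwb]
      split_ifs <;> omega

theorem wtq_div_pow_add_mod_pow (q : ℕ) (hq : 2 ≤ q) (m a : ℕ) :
    wtq q (a / q ^ m) + wtq q (a % q ^ m) = wtq q a := by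
  induction m generalizing a with
  | zero => simp [Nat.mod_one, wtq]
  | succ m ih =>
    have hr : a % q < q := Nat.mod_lt _ (by omega)
    have hwa := wtq_mul_add q (a / q) (a % q) hq hr
    rw [Nat.div_add_mod] at hwa
    rw [pow_succ', Nat.mod_mul, add_comm (a % q), wtq_mul_add q _ _ hq hr,
      ← Nat.div_div_eq_div_mul, hwa, ← ih (a / q)]
    omega

theorem wtq_pow_sub_one (q : ℕ) (hq : 2 ≤ q) (m : ℕ) : wtq q (q ^ m - 1) = m := by
  induction m with
  | zero => simp [wtq]
  | succ m ih =>
    have h := wtq_mul_add q (q ^ m - 1) (q - 1) hq (by omega)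
    have hp : 1 ≤ q ^ m := Nat.one_le_pow _ _ (by omega)
    have hle : q ≤ q * q ^ m := Nat.le_mul_of_pos_right q hp
    have he : q * (q ^ m - 1) + (q - 1) = q ^ (m + 1) - 1 := by
      rw [Nat.mul_sub, pow_succ', mul_one]
      omega
    rw [he, ih, if_neg (by omega)] at h
    omega

/-- For `q ≥ 2`, `m ≥ 2`, `1 ≤ h ≤ m - 1`, every integer `a ≥ 1` of base-`q`
weight at most `h` is congruent modulo `q^m - 1` to some `ã` with `1 ≤ ã ≤ q^m - 2` and
base-`q` weight at most `h`. -/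
theorem stmt3 (q m h : ℕ) (hq : 2 ≤ q) (hm : 2 ≤ m) (hh1 : 1 ≤ h) (hh2 : h ≤ m - 1)
    (a : ℕ) (ha : 1 ≤ a) (hw : wtq q a ≤ h) :
    ∃ b : ℕ, 1 ≤ b ∧ b ≤ q ^ m - 2 ∧ b ≡ a [MOD q ^ m - 1] ∧ wtq q b ≤ h := by
  induction a using Nat.strong_induction_on with
  | _ a ih =>
    have hp : 2 ≤ q ^ m := hq.trans (Nat.le_self_pow (by omega) q)
    by_cases hlt : a < q ^ m
    · refine ⟨a, ha, ?_, rfl, hw⟩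
      have hne : a ≠ q ^ m - 1 := by
        rintro rfl
        rw [wtq_pow_sub_one q hq] at hw
        omega
      omega
    · have hdm := Nat.div_add_mod a (q ^ m)
      have hd : 1 ≤ a / q ^ m := Nat.div_pos (by omega) (by omega)
      have hmul : 2 * (a / q ^ m) ≤ q ^ m * (a / q ^ m) := Nat.mul_le_mul_right _ hp
      have hwt := wtq_add_le q hq (a / q ^ m) (a % q ^ m)
      rw [wtq_div_pow_add_mod_pow q hq] at hwt
      obtain ⟨b, hb1, hb2, hb3, hb4⟩ :=
        ih (a / q ^ m + a % q ^ m) (by omega) (Nat.le_add_right_of_le hd) (hwt.trans hw)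
      refine ⟨b, hb1, hb2, hb3.trans ?_, hb4⟩
      refine (Nat.modEq_iff_dvd' (by omega)).mpr ⟨a / q ^ m, ?_⟩
      rw [Nat.sub_mul, one_mul]
      omega
end

section
/- For every odd integer m ≥ 3, the minimum distance satisfies d̄(3, m, 1) ≤ 10. -/
/-- `I(q,m,h)`: the set of integers `a` with `1 ≤ a ≤ q^m - 2` whose base-`q`
weight is at most `h`. -/
def Iset (q m h : ℕ) : Set ℕ := {a | 1 ≤ a ∧ a ≤ q ^ m - 2 ∧ wtq q a ≤ h}

/-- Hamming weight of a coefficient vector: the number of nonzero coordinates. -/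
noncomputable def hwt {R : Type*} [Zero R] {n : ℕ} (c : Fin n → R) : ℕ :=
  Set.ncard {i | c i ≠ 0}

/-- Membership in the code `Ω(q,m,h)` with respect to the primitive element `α`
of `L = F_{q^m}`: the polynomial `c(x) = ∑ c_i x^i` (coefficients in `K = F_q`)
vanishes at `α^a` for all `a ∈ I(q,m,h)`. -/
def inOmega {K L : Type*} [Field K] [Field L] [Algebra K L] (q m h : ℕ) (α : L)
    (c : Fin (q ^ m - 1) → K) : Prop :=
  ∀ a ∈ Iset q m h, ∑ i, algebraMap K L (c i) * α ^ (a * (i : ℕ)) = 0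

/-- Membership in the code `Ω̄(q,m,h)` with respect to the primitive element `α`
of `L = F_{q^m}`: the polynomial `c(x) = ∑ c_i x^i` (coefficients in `K = F_q`)
vanishes at `1` and at `α^a` and `α^{-a}` for all `a ∈ I(q,m,h)`. -/
def inOmegaBar {K L : Type*} [Field K] [Field L] [Algebra K L] (q m h : ℕ) (α : L)
    (c : Fin (q ^ m - 1) → K) : Prop :=
  (∑ i, algebraMap K L (c i) = 0) ∧
  ∀ a ∈ Iset q m h,
    (∑ i, algebraMap K L (c i) * α ^ (a * (i : ℕ)) = 0) ∧
    (∑ i, algebraMap K L (c i) * α⁻¹ ^ (a * (i : ℕ)) = 0)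

theorem wtq_pos {a : ℕ} (ha : a ≠ 0) : 0 < wtq 3 a := by
  have hne : Nat.digits 3 a ≠ [] := Nat.digits_ne_nil_iff_ne_zero.mpr ha
  unfold wtq
  exact List.length_pos_of_mem (List.mem_filter.mpr
    ⟨List.getLast_mem hne, by simpa using Nat.getLast_digit_ne_zero 3 ha⟩)

theorem wtq_eq_add_wtq_div {a : ℕ} (ha : a ≠ 0) :
    wtq 3 a = (if a % 3 ≠ 0 then 1 else 0) + wtq 3 (a / 3) := by
  unfold wtq
  rw [Nat.digits_def' (by norm_num) (Nat.pos_of_ne_zero ha), List.filter_cons]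
  by_cases h : a % 3 = 0 <;> simp [h, add_comm]

/-- A ternary polynomial vanishing at `β` and `β ^ 2` vanishes at `β ^ a` for every `a` of
ternary weight one. -/
theorem sum_mul_pow_eq_zero_of_wtq_le_one {K L ι : Type*} [Field K] [Fintype K] [Field L]
    [Algebra K L] [Fintype ι] [CharP L 3] (hK : Fintype.card K = 3) (c : ι → K) (e : ι → ℕ) (β : L)
    (h1 : ∑ i, algebraMap K L (c i) * β ^ e i = 0)
    (h2 : ∑ i, algebraMap K L (c i) * β ^ (2 * e i) = 0) (a : ℕ) :
    1 ≤ a → wtq 3 a ≤ 1 → ∑ i, algebraMap K L (c i) * β ^ (a * e i) = 0 := by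
  induction a using Nat.strong_induction_on with
  | _ a ih =>
  intro ha hw
  rw [wtq_eq_add_wtq_div (by omega)] at hw
  by_cases h : a % 3 = 0
  · have hb := ih (a / 3) (by omega) (by omega) (by simpa [h] using hw)
    have := Fact.mk Nat.prime_three
    have hs := sum_pow_char 3 Finset.univ fun i => algebraMap K L (c i) * β ^ (a / 3 * e i)
    rw [hb, zero_pow (by norm_num)] at hs
    rw [hs]
    refine Finset.sum_congr rfl fun i _ => ?_
    have hc : c i ^ 3 = c i := hK ▸ FiniteField.pow_card (c i)
    rw [mul_pow, ← map_pow, hc, ← pow_mul]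
    congr 2
    conv_lhs => rw [show a = a / 3 * 3 by omega]
    ring
  · have hz : a / 3 = 0 := by
      by_contra hne
      have := wtq_pos hne
      simp only [ne_eq, h, not_false_eq_true, if_true] at hw
      omega
    obtain rfl | rfl : a = 1 ∨ a = 2 := by omega
    · simpa using h1
    · exact h2

theorem three_mul_pow_four_lt_choose {n : ℕ} (hn : 26 ≤ n) :
    3 * (n + 1) ^ 4 < n.choose 5 * 32 := by
  obtain ⟨k, rfl⟩ := Nat.exists_eq_add_of_le' hn
  have h := Nat.descFactorial_eq_factorial_mul_choose (k + 26) 5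
  simp only [Nat.descFactorial, Nat.factorial, Nat.sub_zero,
    show k + 26 - 1 = k + 25 by omega, show k + 26 - 2 = k + 24 by omega,
    show k + 26 - 3 = k + 23 by omega, show k + 26 - 4 = k + 22 by omega] at h
  have : 360 * (k + 26 + 1) ^ 4
      < 32 * ((k + 22) * ((k + 23) * ((k + 24) * ((k + 25) * (k + 26))))) := by
    ring_nf
    nlinarith [Nat.zero_le (k ^ 2), Nat.zero_le (k ^ 3), Nat.zero_le (k ^ 4), Nat.zero_le (k ^ 5)]
  simp only [mul_one] at h
  omega

/-- The vector with entries `2` on `p.2`, `1` on `p.1 \ p.2` and `0` elsewhere, when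
`p.2 ⊆ p.1`. -/
def indicatorSum (K : Type*) [Field K] {ι : Type*} [DecidableEq ι]
    (p : (_ : Finset ι) × Finset ι) (i : ι) : K :=
  (if i ∈ p.1 then 1 else 0) + (if i ∈ p.2 then 1 else 0)

theorem indicatorSum_eq_zero {K ι : Type*} [Field K] [DecidableEq ι]
    {p : (_ : Finset ι) × Finset ι} (hp : p.2 ⊆ p.1) {i : ι} (hi : i ∉ p.1) :
    indicatorSum K p i = 0 := by
  simp [indicatorSum, hi, Finset.notMem_mono hp hi]

theorem indicatorSum_injOn {K ι : Type*} [Field K] [DecidableEq ι] (h2 : (2 : K) ≠ 0) :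
    Set.InjOn (indicatorSum K) {p : (_ : Finset ι) × Finset ι | p.2 ⊆ p.1} := by
  have h11 : (1 : K) + 1 ≠ 0 := by rwa [one_add_one_eq_two]
  rintro ⟨S, T⟩ hp ⟨S', T'⟩ hp' h
  simp only [Set.mem_ofPred_eq] at hp hp'
  have key : ∀ i, (i ∈ S ↔ i ∈ S') ∧ (i ∈ T ↔ i ∈ T') := by
    intro i
    have hi := congrFun h i
    have h1 := @hp i
    have h1' := @hp' i
    simp only [indicatorSum] at hi
    by_cases a : i ∈ S <;> by_cases b : i ∈ T <;> by_cases c : i ∈ S' <;>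
      by_cases d : i ∈ T' <;> simp_all
  obtain rfl : S = S' := Finset.ext fun i => (key i).1
  obtain rfl : T = T' := Finset.ext fun i => (key i).2
  rfl

/-- For every odd `m ≥ 3`, the minimum distance of `Ω̄(3, m, 1)` is at most
`10`, i.e. there is a nonzero codeword of Hamming weight at most `10`. -/
theorem stmt11 (m : ℕ) (hm : 3 ≤ m) (hmo : Odd m)
    (K L : Type) [Field K] [Fintype K] [Field L] [Fintype L] [Algebra K L]
    (hcardK : Fintype.card K = 3) (hcardL : Fintype.card L = 3 ^ m)
    (α : L) (hα : orderOf α = 3 ^ m - 1) :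
    ∃ c : Fin (3 ^ m - 1) → K, c ≠ 0 ∧ inOmegaBar 3 m 1 α c ∧ hwt c ≤ 10 := by
  classical
  have := Fact.mk Nat.prime_three
  have hK3 : CharP K 3 := charP_of_card_eq_prime hcardK
  have hL3 : CharP L 3 := charP_of_injective_algebraMap (algebraMap K L).injective 3
  have h2 : (2 : K) ≠ 0 := by
    intro h
    have := (CharP.cast_eq_zero_iff K 3 2).mp (by exact_mod_cast h)
    omega
  have hpow : 27 ≤ 3 ^ m := Nat.pow_le_pow_right (n := 3) (by norm_num) hm
  let ev (c : Fin (3 ^ m - 1) → K) (β : L) (d : ℕ) : L :=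
    ∑ i, algebraMap K L (c i) * β ^ (d * (i : ℕ))
  have ev_sub : ∀ c c' β d, ev (c - c') β d = ev c β d - ev c' β d := by
    intro c c' β d
    simp [ev, sub_mul, Finset.sum_sub_distrib]
  let syn (c : Fin (3 ^ m - 1) → K) : K × L × L × L × L :=
    (∑ i, c i, ev c α 1, ev c α 2, ev c α⁻¹ 1, ev c α⁻¹ 2)
  let P : Finset ((_ : Finset (Fin (3 ^ m - 1))) × Finset (Fin (3 ^ m - 1))) :=
    (Finset.powersetCard 5 Finset.univ).sigma fun S => S.powerset
  have hP : ∀ p ∈ P, p.1.card = 5 ∧ p.2 ⊆ p.1 := by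
    intro p hp
    simpa [P] using hp
  have hcardP : P.card = (3 ^ m - 1).choose 5 * 32 := by
    rw [Finset.card_sigma, Finset.sum_congr rfl (g := fun _ => 32)]
    · simp
    · intro S hS
      rw [Finset.card_powerset, (Finset.mem_powersetCard.mp hS).2]
      norm_num
  obtain ⟨p, hp, p', hp', hne, heq⟩ :=
    Finset.exists_ne_map_eq_of_card_lt_of_maps_to (s := P) (t := Finset.univ)
      (f := fun p => syn (indicatorSum K p))
      (by
        have h := three_mul_pow_four_lt_choose (n := 3 ^ m - 1) (by omega)
        rw [Nat.sub_add_cancel (by omega)] at h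
        rw [hcardP, Finset.card_univ]
        simp only [Fintype.card_prod, hcardK, hcardL]
        calc _ = 3 * (3 ^ m) ^ 4 := by ring
          _ < _ := h)
      (fun _ _ => Finset.mem_coe.mpr (Finset.mem_univ _))
  simp only [syn, Prod.mk.injEq] at heq
  obtain ⟨e0, e1, e2, e3, e4⟩ := heq
  refine ⟨indicatorSum K p - indicatorSum K p', ?_, ⟨?_, ?_⟩, ?_⟩
  · exact fun h => hne (indicatorSum_injOn h2 (hP p hp).2 (hP p' hp').2 (sub_eq_zero.mp h))
  · rw [← map_sum]
    simp [Finset.sum_sub_distrib, e0]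
  · rintro a ⟨ha, -, hw⟩
    exact ⟨sum_mul_pow_eq_zero_of_wtq_le_one hcardK _ _ α
        (by simpa only [ev, one_mul] using (ev_sub _ _ α 1).trans (sub_eq_zero.mpr e1))
        ((ev_sub _ _ α 2).trans (sub_eq_zero.mpr e2)) a ha hw,
      sum_mul_pow_eq_zero_of_wtq_le_one hcardK _ _ α⁻¹
        (by simpa only [ev, one_mul] using (ev_sub _ _ α⁻¹ 1).trans (sub_eq_zero.mpr e3))
        ((ev_sub _ _ α⁻¹ 2).trans (sub_eq_zero.mpr e4)) a ha hw⟩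
  · have hsub : {i | (indicatorSum K p - indicatorSum K p') i ≠ 0} ⊆ ↑(p.1 ∪ p'.1) := by
      intro i hi
      by_contra hmem
      simp only [Finset.coe_union, Set.mem_union, Finset.mem_coe, not_or] at hmem
      exact hi (by simp [indicatorSum_eq_zero (hP p hp).2 hmem.1,
        indicatorSum_eq_zero (hP p' hp').2 hmem.2])
    calc hwt _ ≤ (↑(p.1 ∪ p'.1) : Set _).ncard := Set.ncard_le_ncard hsub (Finset.finite_toSet _)
      _ = (p.1 ∪ p'.1).card := Set.ncard_coe_finset _
      _ ≤ p.1.card + p'.1.card := Finset.card_union_le _ _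
      _ = 10 := by rw [(hP p hp).1, (hP p' hp').1]
end

section
/- Let q be a prime power and a an integer with 1 ≤ a ≤ q − 2 and gcd(a, q) = 1, and set e = q + a. Suppose the multiplicative order l of (−a) modulo e is odd. Then for every odd integer λ ≥ 1 with λ·l ≥ 2, the minimum distance satisfies d̄(q, λ·l, 1) ≤ 2e. -/
theorem not_dvd_of_wtq_le_one {q e : ℕ} (hq : 2 ≤ q) (hqe : q ≤ e) (hcop : Nat.Coprime e q)
    (b : ℕ) (hb : 1 ≤ b) (hw : wtq q b ≤ 1) : ¬ e ∣ b := by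
  induction b using Nat.strong_induction_on with
  | _ b ih =>
    intro hdvd
    have hdig : Nat.digits q b = (b % q) :: Nat.digits q (b / q) :=
      Nat.digits_def' (by omega) (by omega)
    by_cases h0 : b % q = 0
    · have hqb : q ∣ b := Nat.dvd_of_mod_eq_zero h0
      have hpos : 1 ≤ b / q := Nat.div_pos (Nat.le_of_dvd (by omega) hqb) (by omega)
      refine ih (b / q) (Nat.div_lt_self (by omega) (by omega)) hpos ?_ ?_
      · simpa [wtq, hdig, h0] using hw
      · rw [← Nat.div_mul_cancel hqb] at hdvd
        exact hcop.dvd_of_dvd_mul_right hdvd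
    · by_cases hlt : b < q
      · exact absurd (Nat.le_of_dvd (by omega) hdvd) (by omega)
      · have hne : b / q ≠ 0 := (Nat.div_pos (by omega) (by omega)).ne'
        have hnil : Nat.digits q (b / q) ≠ [] := Nat.digits_ne_nil_iff_ne_zero.mpr hne
        have hlast := Nat.getLast_digit_ne_zero q hne
        have hmem : (Nat.digits q (b / q)).getLast hnil ∈
            (Nat.digits q (b / q)).filter (fun d => d ≠ 0) := by
          simpa [List.mem_filter] using hlast
        have hlen := List.length_pos_of_mem hmem
        have hlen_eq : wtq q b = ((Nat.digits q (b / q)).filter (fun d => d ≠ 0)).length + 1 := by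
          simp [wtq, hdig, h0]
        omega

/-- The `i`-th coefficient of `(1 - x) * (1 + x ^ d + x ^ (2 * d) + ⋯)`, for `2 ≤ d`. -/
def cosetDiff (K : Type*) [Field K] (d i : ℕ) : K :=
  if i % d = 0 then 1 else if i % d = 1 then -1 else 0

theorem sum_cosetDiff {K L : Type*} [Field K] [Field L] [Algebra K L] {d : ℕ} (hd : 2 ≤ d)
    (e : ℕ) (x : L) :
    ∑ i ∈ Finset.range (d * e), algebraMap K L (cosetDiff K d i) * x ^ i =
      (∑ k ∈ Finset.range e, (x ^ d) ^ k) * (1 - x) := by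
  have hblock (k : ℕ) : ∑ r ∈ Finset.range d,
      algebraMap K L (cosetDiff K d (d * k + r)) * x ^ (d * k + r) = (x ^ d) ^ k * (1 - x) := by
    obtain ⟨t, rfl⟩ := Nat.exists_eq_add_of_le' hd
    rw [Finset.sum_range_succ', Finset.sum_range_succ', Finset.sum_eq_zero]
    · simp [cosetDiff, pow_add, pow_mul]
      ring
    · intro r hr
      have hr' : r + 1 + 1 < t + 2 := by simpa using hr
      simp [cosetDiff, Nat.mod_eq_of_lt hr']
  induction e with
  | zero => simp
  | succ e ih =>
    rw [Nat.mul_succ, Finset.sum_range_add, ih, hblock, Finset.sum_range_succ, add_mul]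

theorem geom_sum_eq_zero_of_pow_eq_one {L : Type*} [Field L] {y : L} {e : ℕ} (hy : y ^ e = 1)
    (hy1 : y ≠ 1) : ∑ k ∈ Finset.range e, y ^ k = 0 := by
  rw [geom_sum_eq hy1, hy, sub_self, zero_div]

theorem hwt_cosetDiff_le {K : Type*} [Field K] {n d e : ℕ} (hn : n = d * e) :
    hwt (fun i : Fin n => cosetDiff K d i) ≤ 2 * e := by
  classical
  let S : Finset ℕ :=
    (Finset.range e).image (fun k => d * k) ∪ (Finset.range e).image (fun k => d * k + 1)
  have hS : S.card ≤ 2 * e := by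
    refine (Finset.card_union_le _ _).trans ?_
    have h1 := Finset.card_image_le (s := Finset.range e) (f := fun k => d * k)
    have h2 := Finset.card_image_le (s := Finset.range e) (f := fun k => d * k + 1)
    simp only [Finset.card_range] at h1 h2
    omega
  refine le_trans ?_ hS
  rw [← Set.ncard_coe_finset]
  refine Set.ncard_le_ncard_of_injOn (fun i : Fin n => (i : ℕ)) ?_ Fin.val_injective.injOn
    S.finite_toSet
  intro i hi
  have hlt : (i : ℕ) / d < e := Nat.div_lt_of_lt_mul (hn ▸ i.isLt)
  have hdiv := Nat.div_add_mod (i : ℕ) d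
  simp only [Set.mem_ofPred_eq, cosetDiff] at hi
  simp only [S, Finset.coe_union, Finset.coe_image, Finset.coe_range, Set.mem_union,
    Set.mem_image, Set.mem_Iio]
  by_cases h0 : (i : ℕ) % d = 0
  · exact Or.inl ⟨_, hlt, by omega⟩
  · by_cases h1 : (i : ℕ) % d = 1
    · exact Or.inr ⟨_, hlt, by omega⟩
    · simp [h0, h1] at hi

/-- Let `q` be a prime power, `1 ≤ a ≤ q - 2` with `gcd(a, q) = 1`, and
`e = q + a`. If the multiplicative order `l` of `-a` modulo `e` is odd, then for every odd
`λ ≥ 1` (with `λ·l ≥ 2`) the minimum distance of `Ω̄(q, λ·l, 1)` is at most `2e`, i.e.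
there is a nonzero codeword of Hamming weight at most `2e`. -/
theorem stmt14 (q a : ℕ) (hq : IsPrimePow q) (ha1 : 1 ≤ a) (ha2 : a ≤ q - 2)
    (hgcd : Nat.gcd a q = 1)
    (l : ℕ) (hl : l = orderOf (-(a : ZMod (q + a)))) (hlodd : Odd l)
    (lam : ℕ) (hlam1 : 1 ≤ lam) (hlamodd : Odd lam) (hm : 2 ≤ lam * l)
    (K L : Type) [Field K] [Fintype K] [Field L] [Fintype L] [Algebra K L]
    (hcardK : Fintype.card K = q) (hcardL : Fintype.card L = q ^ (lam * l))
    (α : L) (hα : orderOf α = q ^ (lam * l) - 1) :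
    ∃ c : Fin (q ^ (lam * l) - 1) → K,
      c ≠ 0 ∧ inOmegaBar q (lam * l) 1 α c ∧ hwt c ≤ 2 * (q + a) := by
  have hq3 : 3 ≤ q := by omega
  have hcop : Nat.Coprime (q + a) q := by simpa using hgcd
  have hdvd : q + a ∣ q ^ (lam * l) - 1 := by
    have hcast : (q : ZMod (q + a)) = -(a : ZMod (q + a)) := by
      rw [eq_neg_iff_add_eq_zero]
      exact_mod_cast ZMod.natCast_self (q + a)
    rw [← ZMod.natCast_eq_zero_iff, Nat.cast_sub (Nat.one_le_pow _ _ (by omega))]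
    push_cast
    rw [hcast, mul_comm, pow_mul, hl, pow_orderOf_eq_one, one_pow, sub_self]
  obtain ⟨d, hd⟩ := hdvd
  have hn : q ^ (lam * l) - 1 = d * (q + a) := by rw [hd, mul_comm]
  have hsq : q * q ≤ q ^ (lam * l) := by
    rw [← sq]
    exact Nat.pow_le_pow_right (by omega) hm
  have h3q : 3 * q ≤ q * q := Nat.mul_le_mul_right _ hq3
  have hd2 : 2 ≤ d := by
    by_contra hlt
    have hle : d * (q + a) ≤ 1 * (q + a) := Nat.mul_le_mul_right _ (by omega)
    omega
  have hsum (x : L) : ∑ i : Fin (q ^ (lam * l) - 1),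
      algebraMap K L (cosetDiff K d i) * x ^ (i : ℕ) =
        (∑ k ∈ Finset.range (q + a), (x ^ d) ^ k) * (1 - x) := by
    rw [Fin.sum_univ_eq_sum_range (fun i => algebraMap K L (cosetDiff K d i) * x ^ i), hn,
      sum_cosetDiff hd2]
  have hzero (β : L) (hβ : orderOf β = q ^ (lam * l) - 1) (b : ℕ)
      (hb : b ∈ Iset q (lam * l) 1) : ∑ i : Fin (q ^ (lam * l) - 1),
        algebraMap K L (cosetDiff K d i) * β ^ (b * (i : ℕ)) = 0 := by
    simp only [pow_mul]
    rw [hsum, geom_sum_eq_zero_of_pow_eq_one, zero_mul]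
    · rw [← pow_mul, ← hn, ← pow_mul, ← orderOf_dvd_iff_pow_eq_one, hβ]
      exact dvd_mul_left _ _
    · rw [← pow_mul, Ne, ← orderOf_dvd_iff_pow_eq_one, hβ, hn, mul_comm b,
        Nat.mul_dvd_mul_iff_left (by omega)]
      exact not_dvd_of_wtq_le_one (by omega) (by omega) hcop b hb.1 hb.2.2
  refine ⟨fun i => cosetDiff K d i, fun h => ?_, ⟨?_, fun b hb => ⟨?_, ?_⟩⟩,
    hwt_cosetDiff_le hn⟩
  · have h0 := congrFun h ⟨0, by omega⟩
    simp [cosetDiff] at h0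
  · simpa using hsum 1
  · exact hzero α hα b hb
  · refine hzero α⁻¹ ?_ b hb
    rw [← hα, orderOf_eq_orderOf_iff]
    intro k
    rw [inv_pow, inv_eq_one]
end
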